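/- Let P^•, Q^• be complete flags in H with associated permutation τ of {1,…,d}, let a_•, b_• be strictly increasing sequences as in the context, and let Λ ∈ Σ°_{P^•,a_•} ∩ Σ°_{Q^•,b_•}. Then dim_k T(Λ) ≤ E + inv(ω∘τ), where ω(i) = d + 1 − i and inv denotes the number of inversions (equivalently, inv(ω∘τ) = d(d−1)/2 − inv(τ)). -/

import Mathlib

open Module Submodule

section Defs

variable (k : Type*) [Field k] {H : Type*} [AddCommGroup H] [Module k H]

/-- A complete flag in `H`, indexed by codimension: `P 0 = H ⊇ P 1 ⊇ ⋯ ⊇ P d = 0`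
with `dim (P i) = d - i`. -/
def IsCompleteFlag (d : ℕ) (P : ℕ → Submodule k H) : Prop :=
  (∀ i ≤ d, Module.finrank k ↥(P i) = d - i) ∧ ∀ i < d, P (i + 1) ≤ P i

/-- `e` is a `(P,Q)`-basis with associated permutation `τ` (0-indexed: the basis vector
`e ℓ` corresponds to `e_{ℓ+1}` of the paper, and `(τ ℓ).val + 1` to `τ(ℓ+1)`):
`e ℓ ∈ P^ℓ ∖ P^{ℓ+1}` and `e ℓ ∈ Q^{τ ℓ} ∖ Q^{τ ℓ + 1}`. -/
def IsFlagPermBasis (d : ℕ) (P Q : ℕ → Submodule k H)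
    (τ : Equiv.Perm (Fin d)) (e : Fin d → H) : Prop :=
  LinearIndependent k e ∧ Submodule.span k (Set.range e) = ⊤ ∧
  (∀ ℓ : Fin d, e ℓ ∈ P ℓ.val ∧ e ℓ ∉ P (ℓ.val + 1)) ∧
  (∀ ℓ : Fin d, e ℓ ∈ Q (τ ℓ).val ∧ e ℓ ∉ Q ((τ ℓ).val + 1))

/-- Complete flags `P`, `Q` are transverse: `P^i ∩ Q^{d-i} = 0` for `0 < i < d`. -/
def FlagsTransverse (d : ℕ) (P Q : ℕ → Submodule k H) : Prop :=
  ∀ i, 0 < i → i < d → P i ⊓ Q (d - i) = ⊥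

/-- Complete flags `P`, `Q` are almost-transverse. -/
def FlagsAlmostTransverse (d : ℕ) (P Q : ℕ → Submodule k H) : Prop :=
  ∃ t, 1 ≤ t ∧ t < d ∧ Module.finrank k ↥(P t ⊓ Q (d - t)) = 1 ∧
    ∀ i, 1 ≤ i → i < d → i ≠ t → Module.finrank k ↥(P i ⊓ Q (d - i)) = 0

/-- The index `i` is active in the sequence `a`. -/
def ActiveIdx (a : ℕ → ℕ) (i : ℕ) : Prop :=
  (i = 0 ∧ 0 < a 0) ∨ (0 < i ∧ a (i - 1) + 1 < a i)

/-- `Λ` lies in the Schubert variety `Σ_{P,a}` (for `Λ` of dimension `r+1`). -/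
def MemSchubert (r : ℕ) (P : ℕ → Submodule k H) (a : ℕ → ℕ) (Λ : Submodule k H) : Prop :=
  ∀ i ≤ r, r + 1 - i ≤ Module.finrank k ↥(Λ ⊓ P (a i))

/-- `Λ` lies in the open subset `Σ°_{P,a}` of the Schubert variety. -/
def MemSchubertOpen (r : ℕ) (P : ℕ → Submodule k H) (a : ℕ → ℕ) (Λ : Submodule k H) : Prop :=
  MemSchubert k r P a Λ ∧
    ∀ i ≤ r, ActiveIdx a i → Module.finrank k ↥(Λ ⊓ P (a i)) = r + 1 - i

/-- `lam` is an adapted basis of `Λ` for the flags `Λ ∩ P^•` and `Λ ∩ Q^•`, with associated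
permutation `σ`: `lam j` lies in the codimension-`j` member of the flag `Λ ∩ P^•` but not in
the codimension-`(j+1)` member (membership in a member of the flag `Λ ∩ P^•` being equivalent
to that member having dimension at least `r + 1 - j`), and likewise for `Λ ∩ Q^•` with `σ j`
in place of `j`. -/
def IsAdaptedBasis (d r : ℕ) (P Q : ℕ → Submodule k H) (Λ : Submodule k H)
    (σ : Equiv.Perm (Fin (r + 1))) (lam : Fin (r + 1) → H) : Prop :=
  LinearIndependent k lam ∧ Submodule.span k (Set.range lam) = Λ ∧
  (∀ j : Fin (r + 1), ∀ i ≤ d,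
    (lam j ∈ Λ ⊓ P i ↔ r + 1 - j.val ≤ Module.finrank k ↥(Λ ⊓ P i))) ∧
  (∀ j : Fin (r + 1), ∀ i ≤ d,
    (lam j ∈ Λ ⊓ Q i ↔ r + 1 - (σ j).val ≤ Module.finrank k ↥(Λ ⊓ Q i)))

/-- The subspace of `Hom(Λ, H/Λ)` of maps `φ` with `φ(Λ ∩ P^{a i}) ⊆ (P^{a i} + Λ)/Λ`
for all `i ∈ S`. -/
def schubertTangent (P : ℕ → Submodule k H) (a : ℕ → ℕ) (Λ : Submodule k H) (S : Set ℕ) :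
    Submodule k (↥Λ →ₗ[k] H ⧸ Λ) :=
  ⨅ i ∈ S, Submodule.compatibleMaps
    (Submodule.comap Λ.subtype (P (a i))) (Submodule.map Λ.mkQ (P (a i)))

/-- The tangent-space model `T(Λ)` at `Λ ∈ Σ°_{P,a} ∩ Σ°_{Q,b}`: all `φ : Λ → H/Λ` with
`φ(Λ ∩ P^{a i}) ⊆ (P^{a i} + Λ)/Λ` for every `i` active in `a` and
`φ(Λ ∩ Q^{b i}) ⊆ (Q^{b i} + Λ)/Λ` for every `i` active in `b`. -/
def pairTangent (r : ℕ) (P Q : ℕ → Submodule k H) (a b : ℕ → ℕ) (Λ : Submodule k H) :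
    Submodule k (↥Λ →ₗ[k] H ⧸ Λ) :=
  schubertTangent k P a Λ {i | i ≤ r ∧ ActiveIdx a i} ⊓
    schubertTangent k Q b Λ {i | i ≤ r ∧ ActiveIdx b i}

/-- The number of inversions of a permutation of `Fin d`. -/
def invCount {d : ℕ} (τ : Equiv.Perm (Fin d)) : ℕ :=
  ((Finset.univ : Finset (Fin d × Fin d)).filter fun p => p.1 < p.2 ∧ τ p.2 < τ p.1).card

end Defs

section FlagLemmas

variable {k : Type*} [Field k] {H : Type*} [AddCommGroup H] [Module k H]

theorem exists_linearIndependent_mem_of_le_finrank :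
    ∀ {n : ℕ} (A : Fin n → Submodule k H), (∀ j : Fin n, n - j.val ≤ finrank k ↥(A j)) →
      ∃ v : Fin n → H, LinearIndependent k v ∧ ∀ j, v j ∈ A j
  | 0, _, _ => ⟨Fin.elim0, linearIndependent_empty_type, fun j => j.elim0⟩
  | n + 1, A, hA => by
    obtain ⟨v, hv, hvA⟩ := exists_linearIndependent_mem_of_le_finrank
      (fun j : Fin n => A j.succ) (fun j => by simpa using hA j.succ)
    obtain ⟨x, hx, hxv⟩ : ∃ x ∈ A 0, x ∉ span k (Set.range v) := by
      by_contra! hle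
      have : FiniteDimensional k ↥(span k (Set.range v)) :=
        FiniteDimensional.span_of_finite k (Set.finite_range v)
      have h₁ : finrank k ↥(A 0) ≤ finrank k ↥(span k (Set.range v)) :=
        Submodule.finrank_mono hle
      have h₂ := finrank_range_le_card (R := k) v
      have h₃ := hA 0
      simp only [Set.finrank, Fintype.card_fin, Fin.val_zero] at h₂ h₃
      omega
    refine ⟨Fin.cons x v, linearIndependent_finCons.2 ⟨hv, hxv⟩, fun j => ?_⟩
    refine Fin.cases ?_ (fun j => ?_) j
    · simpa using hx
    · simpa using hvA j

theorem finrank_comap_subtype (L S : Submodule k H) :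
    finrank k ↥(S.comap L.subtype) = finrank k ↥(L ⊓ S) := by
  rw [← Submodule.map_comap_subtype, finrank_map_subtype_eq]

theorem finrank_map_mkQ_add_finrank_inf [FiniteDimensional k H] (L S : Submodule k H) :
    finrank k ↥(S.map L.mkQ) + finrank k ↥(L ⊓ S) = finrank k ↥S := by
  have h := (L.mkQ.comp S.subtype).finrank_range_add_finrank_ker
  rwa [LinearMap.range_comp, range_subtype, LinearMap.ker_comp, ker_mkQ,
    finrank_comap_subtype, inf_comm] at h

theorem IsCompleteFlag.le {d : ℕ} {P : ℕ → Submodule k H} (hP : IsCompleteFlag k d P)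
    {m n : ℕ} (hmn : m ≤ n) (hn : n ≤ d) : P n ≤ P m := by
  induction n, hmn using Nat.le_induction with
  | base => exact le_rfl
  | succ n _ ih => exact (hP.2 n hn).trans (ih (by omega))

/-- A basis adapted to a complete flag in the order `σ` has vanishing coordinates below the
level of the flag. -/
theorem IsCompleteFlag.repr_eq_zero {d : ℕ} {P : ℕ → Submodule k H}
    (hP : IsCompleteFlag k d P) (e : Basis (Fin d) k H) (σ : Equiv.Perm (Fin d))
    (he : ∀ l, e l ∈ P (σ l).val) {m : ℕ} (hm : m ≤ d) {x : H} (hx : x ∈ P m)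
    {i : Fin d} (hi : (σ i).val < m) : e.repr x i = 0 := by
  have := Module.Finite.of_basis e
  let s : Finset (Fin d) := Finset.univ.filter fun l => m ≤ (σ l).val
  have hs : s.card = d - m := by
    have h₁ : s.card = (Finset.univ.filter fun l : Fin d => m ≤ l.val).card := by
      refine Finset.card_equiv σ fun l => ?_
      simp [s]
    have h₂ := Finset.card_filter_add_card_filter_not
      (s := (Finset.univ : Finset (Fin d))) (fun l : Fin d => l.val < m)
    have h₃ := Fin.card_filter_val_lt (n := d) (m := m)
    simp only [not_lt, Finset.card_univ, Fintype.card_fin] at h₂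
    omega
  have hle : span k (e '' s) ≤ P m := by
    rw [span_le]
    rintro _ ⟨l, hl, rfl⟩
    have hl' : m ≤ (σ l).val := by simpa [s] using hl
    exact hP.le hl' (σ l).isLt.le (he l)
  have hdim : finrank k ↥(span k (e '' s)) = finrank k ↥(P m) := by
    have hli : LinearIndependent k (fun l : s => e l) :=
      e.linearIndependent.comp _ Subtype.val_injective
    have h := finrank_span_eq_card hli
    have hr : Set.range (fun l : s => e l) = e '' s := by
      ext; simp
    rw [hr, Fintype.card_coe, hs] at h
    rw [h, hP.1 m hm]
  rw [← Submodule.eq_of_le_of_finrank_eq hle hdim, e.mem_span_image] at hx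
  by_contra hne
  have : m ≤ (σ i).val := by simpa [s] using hx (Finsupp.mem_support_iff.2 hne)
  omega

/-- An endomorphism preserving every member of the flag induces an element of the tangent
model. -/
theorem mem_schubertTangent_of_preserves {P : ℕ → Submodule k H} {a : ℕ → ℕ}
    {L : Submodule k H} {S : Set ℕ} (F : H →ₗ[k] H)
    (hF : ∀ i ∈ S, ∀ x ∈ P (a i), F x ∈ P (a i)) :
    L.mkQ.comp (F.comp L.subtype) ∈ schubertTangent k P a L S := by
  simp only [schubertTangent, Submodule.mem_iInf]
  intro i hi x hx
  exact ⟨F x, hF i hi x hx, rfl⟩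

theorem schubertTangent_apply_mem {P : ℕ → Submodule k H} {a : ℕ → ℕ}
    {L : Submodule k H} {S : Set ℕ} {φ : ↥L →ₗ[k] H ⧸ L}
    (hφ : φ ∈ schubertTangent k P a L S) {i : ℕ} (hi : i ∈ S) {x : ↥L}
    (hx : (x : H) ∈ P (a i)) : φ x ∈ (P (a i)).map L.mkQ := by
  simp only [schubertTangent, Submodule.mem_iInf] at hφ
  exact hφ i hi hx

theorem le_and_lt_of_strict {a : ℕ → ℕ} {r d : ℕ} (ha : ∀ i < r, a i < a (i + 1))
    (had : a r < d) {i : ℕ} (hi : i ≤ r) : i ≤ a i ∧ a i < d := by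
  constructor
  · induction i with
    | zero => omega
    | succ i ih =>
      have := ih (by omega)
      have := ha i (by omega)
      omega
  · induction hi using Nat.decreasingInduction with
    | self => exact had
    | of_succ j hj ih => exact (ha j hj).trans ih

theorem exists_submodule_schubertTangent_apply_mem [FiniteDimensional k H] {d r : ℕ}
    (hH : finrank k H = d) {P : ℕ → Submodule k H} (hP : IsCompleteFlag k d P) {a : ℕ → ℕ}
    (ha : ∀ i < r, a i < a (i + 1)) (had : a r < d) {L : Submodule k H}
    (hL : finrank k ↥L = r + 1) (hLa : MemSchubertOpen k r P a L) :
    ∀ j ≤ r, ∃ C : Submodule k (H ⧸ L), finrank k ↥C + a j + r + 1 = d + j ∧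
      ∀ φ ∈ schubertTangent k P a L {i | i ≤ r ∧ ActiveIdx a i}, ∀ x : ↥L,
        (x : H) ∈ P (a j) → φ x ∈ C := by
  intro j
  have hquot := L.finrank_quotient_add_finrank
  induction j with
  | zero =>
    intro hj
    by_cases hact : ActiveIdx a 0
    · refine ⟨(P (a 0)).map L.mkQ, ?_, fun φ hφ x hx =>
        schubertTangent_apply_mem hφ ⟨hj, hact⟩ hx⟩
      have h₁ := finrank_map_mkQ_add_finrank_inf L (P (a 0))
      have h₂ := hLa.2 0 hj hact
      have h₃ := (le_and_lt_of_strict ha had hj).2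
      have h₄ := hP.1 (a 0) h₃.le
      omega
    · refine ⟨⊤, ?_, fun _ _ _ _ => trivial⟩
      have h₀ : a 0 = 0 := Nat.eq_zero_of_not_pos fun h => hact (Or.inl ⟨rfl, h⟩)
      rw [finrank_top]
      omega
  | succ j ih =>
    intro hj
    have h₃ := (le_and_lt_of_strict ha had hj).2
    by_cases hact : ActiveIdx a (j + 1)
    · refine ⟨(P (a (j + 1))).map L.mkQ, ?_, fun φ hφ x hx =>
        schubertTangent_apply_mem hφ ⟨hj, hact⟩ hx⟩
      have h₁ := finrank_map_mkQ_add_finrank_inf L (P (a (j + 1)))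
      have h₂ := hLa.2 (j + 1) hj hact
      have h₄ := hP.1 (a (j + 1)) h₃.le
      omega
    · obtain ⟨C, hC, hCφ⟩ := ih (by omega)
      have hlt := ha j (by omega)
      simp only [ActiveIdx, Nat.add_sub_cancel] at hact
      exact ⟨C, by omega, fun φ hφ x hx => hCφ φ hφ x (hP.le hlt.le h₃.le hx)⟩

/-- The tangent model of a single open Schubert variety has at most the expected dimension. -/
theorem finrank_schubertTangent_le [FiniteDimensional k H] {d r : ℕ}
    (hH : finrank k H = d) {P : ℕ → Submodule k H} (hP : IsCompleteFlag k d P) {a : ℕ → ℕ}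
    (ha : ∀ i < r, a i < a (i + 1)) (had : a r < d) {L : Submodule k H}
    (hL : finrank k ↥L = r + 1) (hLa : MemSchubertOpen k r P a L) :
    (finrank k ↥(schubertTangent k P a L {i | i ≤ r ∧ ActiveIdx a i}) : ℤ) ≤
      ((r : ℤ) + 1) * ((d : ℤ) - r - 1) - ∑ i ∈ Finset.range (r + 1), ((a i : ℤ) - i) := by
  obtain ⟨v, hv, hvP⟩ := exists_linearIndependent_mem_of_le_finrank
    (fun j : Fin (r + 1) => (P (a j)).comap L.subtype) (fun j => by
      rw [finrank_comap_subtype]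
      exact hLa.1 j (Nat.lt_succ_iff.1 j.isLt))
  have hex := exists_submodule_schubertTangent_apply_mem hH hP ha had hL hLa
  choose C hC hCφ using fun j : Fin (r + 1) => hex j (Nat.lt_succ_iff.1 j.isLt)
  set T := schubertTangent k P a L {i | i ≤ r ∧ ActiveIdx a i}
  let ev : ↥T →ₗ[k] (∀ j, ↥(C j)) := LinearMap.pi fun j =>
    ((LinearMap.applyₗ (v j)).comp T.subtype).codRestrict (C j)
      fun φ => hCφ j φ φ.2 (v j) (hvP j)
  have hinj : Function.Injective ev := by
    intro φ ψ h
    refine Subtype.ext (LinearMap.ext_on_range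
      (hv.span_eq_top_of_card_eq_finrank' (by simp [hL])) fun j => ?_)
    exact congrArg Subtype.val (congrFun h j)
  have hle := LinearMap.finrank_le_finrank_of_injective hinj
  rw [Module.finrank_pi_fintype] at hle
  have hsum : ((∑ j, finrank k ↥(C j) : ℕ) : ℤ) =
      ∑ j : Fin (r + 1), (((d : ℤ) - r - 1) - ((a j : ℤ) - (j : ℕ))) := by
    push_cast
    refine Finset.sum_congr rfl fun j _ => ?_
    have := hC j
    omega
  rw [Fin.sum_univ_eq_sum_range (fun j => ((d : ℤ) - r - 1) - ((a j : ℤ) - j)),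
    Finset.sum_sub_distrib] at hsum
  simp only [Finset.sum_const, Finset.card_range, nsmul_eq_mul] at hsum
  push_cast at hsum
  rw [← hsum]
  exact_mod_cast hle

theorem invCount_trans_revPerm {d : ℕ} (τ : Equiv.Perm (Fin d)) :
    invCount (τ.trans Fin.revPerm) =
      (Finset.univ.filter fun p : Fin d × Fin d => p.1 < p.2 ∧ τ p.1 < τ p.2).card := by
  simp [invCount]

/-- The codimension of the sum of the two tangent models is bounded by the number of matrix
units preserving neither flag. -/
theorem finrank_hom_le_finrank_sup_schubertTangent [FiniteDimensional k H] {d : ℕ}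
    {P Q : ℕ → Submodule k H} (hP : IsCompleteFlag k d P) (hQ : IsCompleteFlag k d Q)
    {τ : Equiv.Perm (Fin d)} {e : Fin d → H} (he : IsFlagPermBasis k d P Q τ e)
    {a b : ℕ → ℕ} {S S' : Set ℕ} (ha : ∀ i ∈ S, a i ≤ d) (hb : ∀ i ∈ S', b i ≤ d)
    (L : Submodule k H) :
    finrank k (↥L →ₗ[k] H ⧸ L) ≤
      finrank k ↥(schubertTangent k P a L S ⊔ schubertTangent k Q b L S') +
        invCount (τ.trans Fin.revPerm) := by
  obtain ⟨hli, hspan, heP, heQ⟩ := he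
  let B : Basis (Fin d) k H := Basis.mk hli hspan.ge
  have hB : ∀ l, B l = e l := fun l => by simp [B]
  let F : Fin d × Fin d → (H →ₗ[k] H) := fun p => (B.coord p.2).smulRight (B p.1)
  let ρ : (H →ₗ[k] H) →ₗ[k] (↥L →ₗ[k] H ⧸ L) :=
    (LinearMap.compRight k L.mkQ).comp (LinearMap.lcomp k H L.subtype)
  have hρ : ∀ G, ρ G = L.mkQ.comp (G.comp L.subtype) := fun _ => rfl
  have hpres : ∀ {R : ℕ → Submodule k H}, IsCompleteFlag k d R → ∀ σ : Equiv.Perm (Fin d),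
      (∀ l, B l ∈ R (σ l).val) → ∀ p : Fin d × Fin d, σ p.2 ≤ σ p.1 → ∀ m ≤ d, ∀ x ∈ R m,
        F p x ∈ R m := by
    intro R hR σ hσ p hp m hm x hx
    have hFx : F p x = B.repr x p.2 • B p.1 := rfl
    rw [hFx]
    by_cases h : (σ p.2).val < m
    · rw [hR.repr_eq_zero B σ hσ hm hx h, zero_smul]
      exact zero_mem _
    · have hp' : (σ p.2).val ≤ (σ p.1).val := hp
      exact smul_mem _ _ (hR.le (by omega) (σ p.1).isLt.le (hσ p.1))
  set T := schubertTangent k P a L S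
  set T' := schubertTangent k Q b L S'
  let s : Finset (Fin d × Fin d) :=
    Finset.univ.filter fun p => p.1 < p.2 ∧ τ p.1 < τ p.2
  let U : Submodule k (↥L →ₗ[k] H ⧸ L) := span k (Set.range fun p : s => ρ (F p))
  have hmem : ∀ p, ρ (F p) ∈ (T ⊔ T') ⊔ U := by
    intro p
    by_cases h₁ : p.2 ≤ p.1
    · refine mem_sup_left (mem_sup_left ?_)
      rw [hρ]
      exact mem_schubertTangent_of_preserves _ fun i hi =>
        hpres hP (Equiv.refl _) (fun l => by simpa [hB] using (heP l).1) p h₁ _ (ha i hi)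
    by_cases h₂ : τ p.2 ≤ τ p.1
    · refine mem_sup_left (mem_sup_right ?_)
      rw [hρ]
      exact mem_schubertTangent_of_preserves _ fun i hi =>
        hpres hQ τ (fun l => by simpa [hB] using (heQ l).1) p h₂ _ (hb i hi)
    · exact mem_sup_right (subset_span ⟨⟨p, by simpa [s] using ⟨not_le.1 h₁, not_le.1 h₂⟩⟩, rfl⟩)
  have htop : (T ⊔ T') ⊔ U = ⊤ := by
    refine eq_top_iff.2 fun φ _ => ?_
    obtain ⟨g, hg⟩ := L.mkQ.exists_rightInverse_of_surjective L.range_mkQ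
    obtain ⟨q, hq⟩ := L.subtype.exists_leftInverse_of_injective L.ker_subtype
    set G : H →ₗ[k] H := g.comp (φ.comp q)
    have hG : ρ G = φ := by
      rw [hρ]
      ext x
      have h₁ := LinearMap.congr_fun hg (φ (q x))
      have h₂ := LinearMap.congr_fun hq x
      simp only [LinearMap.comp_apply, LinearMap.id_apply, Submodule.subtype_apply] at h₁ h₂
      simp only [G, LinearMap.comp_apply, Submodule.subtype_apply]
      rw [h₁, h₂]
    have hsum : G = ∑ i, ∑ j, B.repr (G (B i)) j • F (j, i) := by
      refine B.ext fun l => ?_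
      simp [F, Finsupp.single_apply, LinearMap.sum_apply, ite_smul, B.sum_repr]
    rw [← hG, hsum]
    simp only [map_sum, map_smul]
    exact sum_mem fun i _ => sum_mem fun j _ => smul_mem _ _ (hmem _)
  have hU : finrank k ↥U ≤ s.card := by
    simpa [Set.finrank] using finrank_range_le_card (R := k) fun p : s => ρ (F p)
  have hle := Submodule.finrank_add_le_finrank_add_finrank (T ⊔ T') U
  rw [htop, finrank_top] at hle
  rw [invCount_trans_revPerm]
  exact hle.trans (Nat.add_le_add_left hU _)

end FlagLemmas

/-- Remark 2.14 of the paper: for arbitrary flags with associated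
permutation `τ` and `Λ ∈ Σ°_{P,a} ∩ Σ°_{Q,b}`,
`dim T(Λ) ≤ E + inv(ω ∘ τ)` where `ω(i) = d + 1 - i` (0-indexed via `Fin.revPerm`). -/
theorem pairTangent_dim_le (k H : Type*) [Field k] [IsAlgClosed k]
    [AddCommGroup H] [Module k H] (d : ℕ) (hd : 1 ≤ d)
    (hH : Module.finrank k H = d) (P Q : ℕ → Submodule k H)
    (hP : IsCompleteFlag k d P) (hQ : IsCompleteFlag k d Q)
    (τ : Equiv.Perm (Fin d)) (hτ : ∃ e : Fin d → H, IsFlagPermBasis k d P Q τ e)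
    (r : ℕ) (a b : ℕ → ℕ)
    (ha : ∀ i < r, a i < a (i + 1)) (had : a r < d)
    (hb : ∀ i < r, b i < b (i + 1)) (hbd : b r < d)
    (Λ : Submodule k H) (hΛ : Module.finrank k ↥Λ = r + 1)
    (hΛa : MemSchubertOpen k r P a Λ) (hΛb : MemSchubertOpen k r Q b Λ) :
    (Module.finrank k ↥(pairTangent k r P Q a b Λ) : ℤ) ≤
      (((r : ℤ) + 1) * ((d : ℤ) - (r : ℤ) - 1) -
          (∑ i ∈ Finset.range (r + 1), ((a i : ℤ) - (i : ℤ))) -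
          (∑ i ∈ Finset.range (r + 1), ((b i : ℤ) - (i : ℤ)))) +
        (invCount (τ.trans Fin.revPerm) : ℤ) := by
  have : FiniteDimensional k H := FiniteDimensional.of_finrank_pos (by omega)
  obtain ⟨e, he⟩ := hτ
  have h₁ := finrank_schubertTangent_le hH hP ha had hΛ hΛa
  have h₂ := finrank_schubertTangent_le hH hQ hb hbd hΛ hΛb
  have h₃ := finrank_hom_le_finrank_sup_schubertTangent hP hQ he
    (S := {i | i ≤ r ∧ ActiveIdx a i}) (S' := {i | i ≤ r ∧ ActiveIdx b i})
    (fun i hi => (le_and_lt_of_strict ha had hi.1).2.le)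
    (fun i hi => (le_and_lt_of_strict hb hbd hi.1).2.le) Λ
  have h₄ := Submodule.finrank_sup_add_finrank_inf_eq
    (schubertTangent k P a Λ {i | i ≤ r ∧ ActiveIdx a i})
    (schubertTangent k Q b Λ {i | i ≤ r ∧ ActiveIdx b i})
  have h₅ : (finrank k (↥Λ →ₗ[k] H ⧸ Λ) : ℤ) = ((r : ℤ) + 1) * ((d : ℤ) - r - 1) := by
    have hquot := Λ.finrank_quotient_add_finrank
    have hq : (finrank k (H ⧸ Λ) : ℤ) = (d : ℤ) - r - 1 := by omega
    rw [Module.finrank_linearMap, hΛ]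
    push_cast
    rw [hq]
  rw [pairTangent]
  zify at h₃ h₄
  linarith
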